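/- arXiv:math/0609556 — 5 statements merged into one kernel-verified Lean document; each statement's English description precedes it below -/
import Mathlib

section
/- Let G be a group and G₀ a normal subgroup of G such that (i) every group homomorphism from G₀ to Circle is trivial, and (ii) every Circle-valued 2-cocycle on G/G₀ is a coboundary (i.e., for every c : G/G₀ × G/G₀ → Circle satisfying c(x,y)·c(xy,z) = c(y,z)·c(x,yz) for all x,y,z, there exists b : G/G₀ → Circle with c(x,y) = b(x)·b(y)·b(xy)⁻¹). Let H be a group, π : H → G a surjective homomorphism, and ι : Circle → H an injective homomorphism whose image is central in H and equals ker π. If there exists a group homomorphism s₀ : G₀ → H with π ∘ s₀ equal to the inclusion of G₀ into G, then the extension splits: there exists a group homomorphism s : G → H with π ∘ s = id on G. -/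
/-- A central extension of `Q` splits if all cocycles on `Q` are coboundaries. -/
lemma splits_of_cob {Q K A : Type*} [Group Q] [Group K] [CommGroup A]
    (hcob : ∀ c : Q → Q → A,
      (∀ x y z, c x y * c (x * y) z = c y z * c x (y * z)) →
      ∃ b : Q → A, ∀ x y, c x y = b x * b y * (b (x * y))⁻¹)
    (p : K →* Q) (hp : Function.Surjective p)
    (i : A →* K) (hi : Function.Injective i)
    (hc : ∀ z k, i z * k = k * i z) (hk : ∀ k, p k = 1 → ∃ z, i z = k) (hpi : ∀ z, p (i z) = 1) :
    ∃ S : Q →* K, ∀ x, p (S x) = x := by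
  choose q hq using hp
  have h1 : ∀ x y, ∃ z, i z = q x * q y * (q (x * y))⁻¹ := fun x y => hk _ (by simp [hq])
  choose c hcc using h1
  have h2 : ∀ x y, q x * q y = i (c x y) * q (x * y) := fun x y => by rw [hcc]; group
  obtain ⟨b, hb⟩ := hcob c (by
    intro x y z
    apply hi
    have e1 : q x * q y * q z = i (c x y * c (x * y) z) * q (x * y * z) := by
      rw [h2, mul_assoc, h2, map_mul, mul_assoc (i _)]
    have e2 : q x * q y * q z = i (c y z * c x (y * z)) * q (x * y * z) := by
      rw [mul_assoc, h2 y z, ← mul_assoc, ← hc, mul_assoc, h2, map_mul, mul_assoc, mul_assoc x]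
    exact mul_right_cancel (e1.symm.trans e2))
  refine ⟨MonoidHom.mk' (fun x => i (b x)⁻¹ * q x) ?_, ?_⟩
  · intro x y
    have e : i (b x)⁻¹ * q x * (i (b y)⁻¹ * q y) = i (b x)⁻¹ * i (b y)⁻¹ * (q x * q y) := by
      rw [mul_assoc, ← mul_assoc (q x), ← hc]
      simp only [mul_assoc]
    rw [e, h2, hb, ← map_mul, ← mul_assoc, ← map_mul]
    congr 2
    rw [mul_assoc (b x), ← mul_assoc, mul_comm (b x)⁻¹]
    simp [mul_assoc]
  · intro x
    simp only [MonoidHom.mk'_apply, map_mul, hpi, hq, one_mul]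

/-- If `G₀` is a normal subgroup of `G` such that every homomorphism
`G₀ → Circle` is trivial and every `Circle`-valued 2-cocycle on `G ⧸ G₀` is a coboundary,
then any central extension of `G` by `Circle` which splits over `G₀` splits over all of `G`. -/
theorem central_extension_splits_of_splits_on_normal_subgroup
    (G H : Type*) [Group G] [Group H]
    (G₀ : Subgroup G) [G₀.Normal]
    (htriv : ∀ f : G₀ →* Circle, ∀ g : G₀, f g = 1)
    (hcob : ∀ c : (G ⧸ G₀) → (G ⧸ G₀) → Circle,
      (∀ x y z, c x y * c (x * y) z = c y z * c x (y * z)) →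
      ∃ b : (G ⧸ G₀) → Circle, ∀ x y, c x y = b x * b y * (b (x * y))⁻¹)
    (π : H →* G) (hπsurj : Function.Surjective π)
    (ι : Circle →* H) (hιinj : Function.Injective ι)
    (hcent : ι.range ≤ Subgroup.center H) (hker : ι.range = π.ker)
    (s₀ : G₀ →* H) (hs₀ : ∀ g : G₀, π (s₀ g) = (g : G)) :
    ∃ s : G →* H, ∀ g, π (s g) = g := by
  have hc : ∀ z k, ι z * k = k * ι z := fun z k =>
    ((Subgroup.mem_center_iff.mp (hcent ⟨z, rfl⟩)) k).symm
  have hk : ∀ k, π k = 1 → ∃ z, ι z = k := fun k h => by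
    have : k ∈ ι.range := by rw [hker]; exact h
    exact this
  have hpi : ∀ z, π (ι z) = 1 := fun z => by
    have : ι z ∈ π.ker := by rw [← hker]; exact ⟨z, rfl⟩
    exact this
  have hconj : ∀ (h : H) (g : G₀),
      h * s₀ g * h⁻¹ = s₀ (MulAut.conjNormal (π h) g) := by
    intro h
    have h1 : ∀ g : G₀, ∃ z, ι z = h * s₀ g * h⁻¹ * (s₀ (MulAut.conjNormal (π h) g))⁻¹ :=
      fun g => hk _ (by simp [hs₀])
    choose f hf using h1
    have hf' : ∀ g : G₀, h * s₀ g * h⁻¹ = ι (f g) * s₀ (MulAut.conjNormal (π h) g) :=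
      fun g => by rw [hf]; group
    have hmul : ∀ a b, f (a * b) = f a * f b := by
      intro a b
      apply hιinj
      apply mul_right_cancel (b := s₀ (MulAut.conjNormal (π h) (a * b)))
      rw [← hf']
      have : h * s₀ (a * b) * h⁻¹ = (h * s₀ a * h⁻¹) * (h * s₀ b * h⁻¹) := by
        rw [map_mul]; group
      rw [this, hf', hf', map_mul, map_mul, map_mul]
      rw [mul_assoc, ← mul_assoc (s₀ _) (ι _), ← hc]
      simp only [mul_assoc]
    intro g
    have := htriv (MonoidHom.mk' f hmul) g
    rw [MonoidHom.mk'_apply] at this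
    rw [hf', this, map_one, one_mul]
  have hN : s₀.range.Normal := ⟨by
    rintro _ ⟨g, rfl⟩ h
    exact ⟨_, (hconj h g).symm⟩⟩
  let p : H ⧸ s₀.range →* G ⧸ G₀ := QuotientGroup.map s₀.range G₀ π (by
    rintro _ ⟨g, rfl⟩
    simp [hs₀])
  have hpm : ∀ h : H, p (h : H ⧸ s₀.range) = ((π h : G) : G ⧸ G₀) := fun h => rfl
  let i : Circle →* H ⧸ s₀.range := (QuotientGroup.mk' s₀.range).comp ι
  have him : ∀ z, i z = ((ι z : H) : H ⧸ s₀.range) := fun z => rfl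
  have hi1 : ∀ z, i z = 1 → z = 1 := by
    intro z hz
    rw [him, QuotientGroup.eq_one_iff] at hz
    obtain ⟨g, hg⟩ := hz
    have h1 : (g : G) = 1 := by rw [← hs₀, hg, hpi]
    have h2 : g = 1 := Subtype.ext h1
    apply hιinj
    rw [← hg, h2, map_one, map_one]
  have hkp : ∀ k, p k = 1 → ∃ z, i z = k := by
    intro k
    obtain ⟨h, rfl⟩ := QuotientGroup.mk_surjective k
    intro hh
    rw [hpm, QuotientGroup.eq_one_iff] at hh
    obtain ⟨z, hz⟩ := hk (h * (s₀ ⟨π h, hh⟩)⁻¹) (by simp [hs₀])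
    refine ⟨z, ?_⟩
    rw [him, hz, QuotientGroup.eq]
    refine ⟨⟨π h, hh⟩, ?_⟩
    group
  obtain ⟨S, hS⟩ := splits_of_cob hcob p
    (by
      intro x
      obtain ⟨g, rfl⟩ := QuotientGroup.mk_surjective x
      obtain ⟨h, rfl⟩ := hπsurj g
      exact ⟨h, rfl⟩)
    i ((injective_iff_map_eq_one i).mpr hi1)
    (by
      intro z k
      obtain ⟨h, rfl⟩ := QuotientGroup.mk_surjective k
      rw [him]
      exact congrArg (QuotientGroup.mk' s₀.range) (hc z h))
    hkp
    (by intro z; rw [him, hpm, hpi]; rfl)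
  -- lifts compatible with `S`
  have hex : ∀ g : G, ∃ h : H, π h = g ∧ (h : H ⧸ s₀.range) = S (g : G ⧸ G₀) := by
    intro g
    obtain ⟨h, rfl⟩ := hπsurj g
    obtain ⟨z, hz⟩ := hkp (S ((π h : G) : G ⧸ G₀) * (h : H ⧸ s₀.range)⁻¹) (by
      rw [map_mul, map_inv, hS, hpm, mul_inv_cancel])
    refine ⟨ι z * h, by rw [map_mul, hpi, one_mul], ?_⟩
    rw [QuotientGroup.mk_mul, ← him, hz, inv_mul_cancel_right]
  have huniq : ∀ h h' : H, π h = π h' → (h : H ⧸ s₀.range) = h' → h = h' := by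
    intro h h' e1 e2
    obtain ⟨z, hz⟩ := hk (h * h'⁻¹) (by rw [map_mul, map_inv, e1, mul_inv_cancel])
    have : z = 1 := hi1 z (by
      rw [him, hz, QuotientGroup.mk_mul, QuotientGroup.mk_inv, e2, mul_inv_cancel])
    rw [this, map_one] at hz
    exact (mul_inv_eq_one.mp hz.symm)
  choose s hs1 hs2 using hex
  refine ⟨MonoidHom.mk' s ?_, hs1⟩
  intro a b
  apply huniq
  · rw [map_mul, hs1, hs1, hs1]
  · rw [QuotientGroup.mk_mul, hs2, hs2, hs2, QuotientGroup.mk_mul, map_mul]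
end

section
/- Let H be a group, ε ∈ H a central element with ε² = 1, and δ : H → ZMod 2 a group homomorphism (into the additive group ZMod 2) with δ(ε) = 0. Then the operation x * y := ε^{(δ(x) · δ(y)).val} · x · y (product in H, where δ(x)·δ(y) is computed in ZMod 2 and .val ∈ {0,1}) defines a group structure on the underlying set of H: it is associative, has identity element 1, and each x has inverse ε^{δ(x).val} · x⁻¹. -/
/-- Let `ε` be a central element of a group `H` with `ε ^ 2 = 1` and let
`δ : H → ZMod 2` be a homomorphism with `δ ε = 0`.  Then the twisted operation
`x * y := ε ^ (δ x · δ y) · x · y` is a group law on the underlying set of `H`: it is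
associative, has identity `1`, and `ε ^ (δ x) · x⁻¹` is a two-sided inverse of `x`. -/
theorem koszul_twisted_multiplication_is_group_law
    (H : Type*) [Group H] (ε : H) (hεcent : ∀ h : H, ε * h = h * ε) (hεsq : ε ^ 2 = 1)
    (δ : H → ZMod 2) (hδ : ∀ x y : H, δ (x * y) = δ x + δ y) (hδε : δ ε = 0)
    (op : H → H → H) (hop : ∀ x y : H, op x y = ε ^ (δ x * δ y).val * (x * y)) :
    (∀ x y z : H, op (op x y) z = op x (op y z)) ∧
    (∀ x : H, op 1 x = x ∧ op x 1 = x) ∧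
    (∀ x : H, op x (ε ^ (δ x).val * x⁻¹) = 1 ∧ op (ε ^ (δ x).val * x⁻¹) x = 1) := by
  have hadd : ∀ a b : ZMod 2, ε ^ (a + b).val = ε ^ a.val * ε ^ b.val := by
    intro a b
    rw [ZMod.val_add, ← pow_add]
    exact (pow_eq_pow_mod _ hεsq).symm
  have hcomm : ∀ (a : ZMod 2) (h : H), h * ε ^ a.val = ε ^ a.val * h := by
    intro a h
    exact ((show Commute ε h from hεcent h).pow_left _).eq.symm
  have hδ1 : δ 1 = 0 := by
    have h := hδ 1 1
    rw [mul_one] at h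
    exact left_eq_add.mp h
  have hδpow : ∀ n : ℕ, δ (ε ^ n) = 0 := by
    intro n
    induction n with
    | zero => rw [pow_zero, hδ1]
    | succ k ih => rw [pow_succ, hδ, ih, hδε, add_zero]
  have hδinv : ∀ x, δ x⁻¹ = δ x := by
    intro x
    have h := hδ x x⁻¹
    rw [mul_inv_cancel, hδ1] at h
    generalize δ x⁻¹ = a at *
    generalize δ x = b at *
    revert a b
    decide
  have hsq : ∀ a : ZMod 2, ε ^ (a * a).val * ε ^ a.val = 1 := by
    intro a
    rw [← hadd]
    have : a * a + a = 0 := by revert a; decide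
    rw [this, ZMod.val_zero, pow_zero]
  refine ⟨?_, ?_, ?_⟩
  · intro x y z
    simp only [hop, hδ, hδpow, zero_add]
    rw [← mul_assoc x (ε ^ _), hcomm, mul_assoc (ε ^ _) (x * y) z, mul_assoc (ε ^ _) x (y * z),
      ← mul_assoc (ε ^ _) (ε ^ _), ← mul_assoc (ε ^ _) (ε ^ _), ← hadd, ← hadd, mul_assoc x y z]
    congr 3
    ring
  · intro x
    simp [hop, hδ1]
  · intro x
    simp only [hop, hδ, hδpow, zero_add, hδinv]
    constructor
    · rw [← mul_assoc x, hcomm, mul_assoc, mul_inv_cancel, mul_one, hsq]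
    · rw [mul_assoc, inv_mul_cancel, mul_one, hsq]
end

section
/- Let G be a group, π : H → G a surjective group homomorphism, ι : Circle → H an injective group homomorphism whose image is central in H and equals ker π, and δ : G → ZMod 2 a group homomorphism. Let P = {(x, y) ∈ H × H : π(x) = π(y)}, equipped with the multiplication (x₁, y₁) * (x₂, y₂) := (ι((-1)^{e}) x₁ x₂, ι((-1)^{e}) y₁ y₂) where e = (δ(π(x₁)) · δ(π(x₂))).val; this makes P a group. Let D = {(ι(μ), ι(μ)) : μ ∈ Circle}, a central subgroup of P. Then the map Φ : G × Circle → P/D which sends (g, λ) to the class of (ι(λ)·x, x) for any x ∈ H with π(x) = g is well defined (independent of the choice of x) and is a group isomorphism. (This expresses that the sum of a graded central extension (H, δ) and its opposite extension (H^op, δ) is the trivial graded extension.) -/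
/-- The element `-1` of the circle group. -/
noncomputable def Circle.negOne : Circle :=
  ⟨-1, by show -1 ∈ Submonoid.unitSphere ℂ; simp [Submonoid.unitSphere]⟩

/-- The underlying set of the fiber product of two groups over `G`, used for sums of
(graded) central extensions of `G`. -/
abbrev FiberProd {G H₁ H₂ : Type*} [Group G] [Group H₁] [Group H₂]
    (π₁ : H₁ →* G) (π₂ : H₂ →* G) : Type _ :=
  {p : H₁ × H₂ // π₁ p.1 = π₂ p.2}

/-- The twisted group structure on the fiber product attached to a 2-cocycle `s`. -/
@[reducible] noncomputable def twistedGroup {G H : Type*} [Group G] [Group H] (π : H →* G) (ι : Circle →* H)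
    (hc : ∀ (m : Circle) (x : H), x * ι m = ι m * x) (hk : ∀ m, π (ι m) = 1)
    (s : G → G → Circle) (h1 : ∀ g, s 1 g = 1)
    (hs : ∀ g h k, s g h * s (g * h) k = s h k * s g (h * k)) : Group (FiberProd π π) :=
  letI : Mul (FiberProd π π) := ⟨fun p q =>
    ⟨(ι (s (π p.1.1) (π q.1.1)) * (p.1.1 * q.1.1), ι (s (π p.1.1) (π q.1.1)) * (p.1.2 * q.1.2)), by
      simp [hk, p.2, q.2]⟩⟩
  letI : One (FiberProd π π) := ⟨⟨(1, 1), rfl⟩⟩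
  letI : Inv (FiberProd π π) := ⟨fun p =>
    ⟨((ι (s (π p.1.1)⁻¹ (π p.1.1)))⁻¹ * p.1.1⁻¹, (ι (s (π p.1.1)⁻¹ (π p.1.1)))⁻¹ * p.1.2⁻¹), by
      have := hk (s (π p.1.1)⁻¹ (π p.1.1))
      simp [hk, p.2]⟩⟩
  have key : ∀ (a b c d : Circle) (x y z : H), a * b = c * d →
      ι b * (ι a * (x * y) * z) = ι d * (x * (ι c * (y * z))) := by
    intro a b c d x y z h
    have h2 : ι b * ι a = ι d * ι c := by rw [← map_mul, ← map_mul, mul_comm b, h, mul_comm]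
    calc ι b * (ι a * (x * y) * z) = (ι b * ι a) * (x * y * z) := by group
      _ = ι d * (ι c * x) * (y * z) := by rw [h2]; group
      _ = _ := by rw [← hc c]; group
  Group.ofLeftAxioms
    (by
      intro p q r
      have e1 : π (ι (s (π p.1.1) (π q.1.1)) * (p.1.1 * q.1.1)) = π p.1.1 * π q.1.1 := by
        simp [hk]
      have e2 : π (ι (s (π q.1.1) (π r.1.1)) * (q.1.1 * r.1.1)) = π q.1.1 * π r.1.1 := by
        simp [hk]
      apply Subtype.ext
      apply Prod.ext
      · change ι (s (π (ι _ * (_ * _))) _) * _ = ι (s _ (π (ι _ * (_ * _)))) * _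
        rw [e1, e2]
        exact key _ _ _ _ _ _ _ (hs _ _ _)
      · change ι (s (π (ι _ * (_ * _))) _) * _ = ι (s _ (π (ι _ * (_ * _)))) * _
        rw [e1, e2]
        exact key _ _ _ _ _ _ _ (hs _ _ _))
    (by
      intro p
      apply Subtype.ext
      apply Prod.ext
      · change ι (s (π 1) _) * (1 * _) = _
        simp [h1]
      · change ι (s (π 1) _) * (1 * _) = _
        simp [h1])
    (by
      intro p
      have e1 : π ((ι (s (π p.1.1)⁻¹ (π p.1.1)))⁻¹ * p.1.1⁻¹) = (π p.1.1)⁻¹ := by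
        simp [hk]
      apply Subtype.ext
      apply Prod.ext
      · change ι (s (π (_ * _)) _) * ((ι _)⁻¹ * _ * _) = 1
        rw [e1]; group
      · change ι (s (π (_ * _)) _) * ((ι _)⁻¹ * _ * _) = 1
        rw [e1]; group)

theorem negOne_sq : Circle.negOne ^ 2 = 1 := by
  apply Circle.ext
  rw [Circle.coe_pow]
  change (-1 : ℂ) ^ 2 = 1
  norm_num

theorem negOne_pow_add (a b : ZMod 2) :
    Circle.negOne ^ (a + b).val = Circle.negOne ^ a.val * Circle.negOne ^ b.val := by
  rw [← pow_add, ZMod.val_add, ← pow_eq_pow_mod _ negOne_sq]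

/-- Let `(H, δ)` be a graded central extension of `G` by `Circle`.  On the
fiber product `P = {(x,y) : π x = π y}` with the sign-twisted product
`(x₁,y₁)(x₂,y₂) = (ι((-1)^e) x₁ x₂, ι((-1)^e) y₁ y₂)`, `e = δ(π x₁)·δ(π x₂)`, and `D` the
diagonal circle, the map `(g, λ) ↦ [(ι(λ)x, x)]` (any `x` with `π x = g`) is a well-defined
group isomorphism `G × Circle ≃* P ⧸ D`: the sum of a graded central extension and its opposite
is trivial. -/
theorem sum_of_graded_extension_and_opposite_is_trivial
    (G H : Type*) [Group G] [Group H]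
    (π : H →* G) (hπsurj : Function.Surjective π)
    (ι : Circle →* H) (hιinj : Function.Injective ι)
    (hcent : ι.range ≤ Subgroup.center H) (hker : ι.range = π.ker)
    (δ : G → ZMod 2) (hδ : ∀ g h : G, δ (g * h) = δ g + δ h) :
    ∃ _ : Group (FiberProd π π),
      (∀ p q : FiberProd π π,
        (p * q).1 =
          (ι (Circle.negOne ^ (δ (π p.1.1) * δ (π q.1.1)).val) * (p.1.1 * q.1.1),
           ι (Circle.negOne ^ (δ (π p.1.1) * δ (π q.1.1)).val) * (p.1.2 * q.1.2))) ∧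
      ∃ D : Subgroup (FiberProd π π),
        (∀ p : FiberProd π π, p ∈ D ↔ ∃ μ : Circle, p.1 = (ι μ, ι μ)) ∧
        D ≤ Subgroup.center (FiberProd π π) ∧
        ∃ _ : D.Normal,
          ∃ Φ : (G × Circle) ≃* (FiberProd π π ⧸ D),
            ∀ (g : G) (l : Circle) (x : H), π x = g →
              ∀ p : FiberProd π π, p.1 = (ι l * x, x) →
                Φ (g, l) = QuotientGroup.mk p := by
  have hc : ∀ (m : Circle) (x : H), x * ι m = ι m * x := fun m x =>
    Subgroup.mem_center_iff.1 (hcent ⟨m, rfl⟩) x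
  have hk : ∀ m, π (ι m) = 1 := fun m => by
    have : ι m ∈ π.ker := hker ▸ ⟨m, rfl⟩
    exact this
  have hδ1 : δ 1 = 0 := by simpa using hδ 1 1
  let inst : Group (FiberProd π π) := twistedGroup π ι hc hk
    (fun g h => Circle.negOne ^ (δ g * δ h).val) (by intro g; simp [hδ1])
    (by
      intro g h k
      simp only [← negOne_pow_add, hδ]
      congr 2; ring)
  have hmul : ∀ p q : FiberProd π π,
        (p * q).1 =
          (ι (Circle.negOne ^ (δ (π p.1.1) * δ (π q.1.1)).val) * (p.1.1 * q.1.1),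
           ι (Circle.negOne ^ (δ (π p.1.1) * δ (π q.1.1)).val) * (p.1.2 * q.1.2)) :=
    fun p q => rfl
  have hex : ∀ p : FiberProd π π, ∃ l : Circle, p.1.1 = ι l * p.1.2 := by
    intro p
    have : p.1.1 * p.1.2⁻¹ ∈ ι.range := by
      rw [hker, MonoidHom.mem_ker, map_mul, map_inv, p.2, mul_inv_cancel]
    obtain ⟨l, hl⟩ := this
    exact ⟨l, by rw [hl]; group⟩
  choose κ hκ using hex
  have huniq : ∀ (p : FiberProd π π) (l : Circle), p.1.1 = ι l * p.1.2 → κ p = l := by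
    intro p l h
    apply hιinj
    exact mul_right_cancel ((hκ p).symm.trans h)
  let Ψ : FiberProd π π →* G × Circle := MonoidHom.mk' (fun p => (π p.1.2, κ p)) (by
    intro p q
    apply Prod.ext
    · change π (p * q).1.2 = π p.1.2 * π q.1.2
      rw [hmul]; simp [hk]
    · change κ (p * q) = κ p * κ q
      apply huniq
      rw [hmul]
      dsimp only
      generalize Circle.negOne ^ (δ (π p.1.1) * δ (π q.1.1)).val = a
      rw [hκ p, hκ q]
      calc ι a * (ι (κ p) * p.1.2 * (ι (κ q) * q.1.2))
          = ι a * ι (κ p) * (p.1.2 * ι (κ q)) * q.1.2 := by group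
        _ = ι (a * κ p * κ q) * (p.1.2 * q.1.2) := by rw [hc (κ q)]; simp only [map_mul]; group
        _ = ι (κ p * κ q * a) * (p.1.2 * q.1.2) := by rw [mul_assoc a, mul_comm a]
        _ = _ := by simp only [map_mul]; group)
  have hΨ : ∀ p, Ψ p = (π p.1.2, κ p) := fun p => rfl
  have hsurj : Function.Surjective Ψ := by
    rintro ⟨g, l⟩
    obtain ⟨x, rfl⟩ := hπsurj g
    refine ⟨⟨(ι l * x, x), by simp [hk]⟩, ?_⟩
    rw [hΨ]
    exact Prod.ext rfl (huniq _ _ rfl)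
  have hD : ∀ p : FiberProd π π, p ∈ Ψ.ker ↔ ∃ μ : Circle, p.1 = (ι μ, ι μ) := by
    intro p
    rw [MonoidHom.mem_ker, hΨ, Prod.mk_eq_one]
    constructor
    · rintro ⟨h1, h2⟩
      have : p.1.2 ∈ ι.range := by rw [hker]; exact h1
      obtain ⟨m, hm⟩ := this
      refine ⟨m, Prod.ext ?_ hm.symm⟩
      rw [hκ p, h2, hm]; simp
    · rintro ⟨m, hm⟩
      refine ⟨by rw [hm]; exact hk m, huniq _ _ ?_⟩
      rw [hm]; simp
  refine ⟨inst, hmul, Ψ.ker, hD, ?_, inferInstance,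
    (QuotientGroup.quotientKerEquivOfSurjective Ψ hsurj).symm, ?_⟩
  · intro p hp
    obtain ⟨m, hm⟩ := (hD p).1 hp
    rw [Subgroup.mem_center_iff]
    intro q
    apply Subtype.ext
    rw [hmul, hmul, hm]
    simp [hk, hδ1, hc]
  · intro g l x hx p hp
    rw [MulEquiv.symm_apply_eq]
    change (g, l) = Ψ p
    rw [hΨ, huniq p l (by rw [hp]), hp, hx]
end

section
/- Let I be a type, let c¹, c² : I × I × I → Circle and δ¹, δ² : I × I → ZMod 2 be functions such that for p = 1, 2 and all i, j, k, l ∈ I: δᵖ(i,j) + δᵖ(j,k) = δᵖ(i,k), and cᵖ(j,k,l) · cᵖ(i,k,l)⁻¹ · cᵖ(i,j,l) · cᵖ(i,j,k)⁻¹ = 1. Define c : I × I × I → Circle by c(i,j,k) = c¹(i,j,k) · c²(i,j,k) · (-1)^{(δ²(i,j) · δ¹(j,k)).val}. Then c also satisfies c(j,k,l) · c(i,k,l)⁻¹ · c(i,j,l) · c(i,j,k)⁻¹ = 1 for all i, j, k, l ∈ I. -/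
theorem sign_cocycle_aux {G : Type*} [CommGroup G] (n : G) (hn : n * n = 1) (a b p q : ZMod 2) :
    n ^ (b * q).val * (n ^ ((a + b) * q).val)⁻¹ * n ^ (a * (p + q)).val
      * (n ^ (a * p).val)⁻¹ = 1 := by
  have hi : n⁻¹ = n := inv_eq_of_mul_eq_one_left hn
  have key : ∀ a b p q : ZMod 2, ((b * q).val + ((a + b) * q).val + (a * (p + q)).val
      + (a * p).val) % 2 = 0 := by decide
  obtain ⟨m, hm⟩ := Nat.dvd_of_mod_eq_zero (key a b p q)
  rw [← inv_pow, ← inv_pow, hi, ← pow_add, ← pow_add, ← pow_add, hm, pow_mul, pow_two, hn, one_pow]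

/-- The sum of two graded Čech twists is again a Čech 2-cocycle: if
`(c¹, δ¹)` and `(c², δ²)` satisfy the Čech cocycle identities, then
`c(i,j,k) = c¹(i,j,k) · c²(i,j,k) · (-1)^{δ²(i,j)·δ¹(j,k)}` satisfies the Čech 2-cocycle
identity. -/
theorem sum_of_graded_cech_twists_is_cocycle
    (I : Type*) (c₁ c₂ : I × I × I → Circle) (δ₁ δ₂ : I × I → ZMod 2)
    (hδ₁ : ∀ i j k : I, δ₁ (i, j) + δ₁ (j, k) = δ₁ (i, k))
    (hδ₂ : ∀ i j k : I, δ₂ (i, j) + δ₂ (j, k) = δ₂ (i, k))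
    (hc₁ : ∀ i j k l : I, c₁ (j, k, l) * (c₁ (i, k, l))⁻¹ * c₁ (i, j, l) * (c₁ (i, j, k))⁻¹ = 1)
    (hc₂ : ∀ i j k l : I, c₂ (j, k, l) * (c₂ (i, k, l))⁻¹ * c₂ (i, j, l) * (c₂ (i, j, k))⁻¹ = 1)
    (c : I × I × I → Circle)
    (hc : ∀ i j k : I,
      c (i, j, k) = c₁ (i, j, k) * c₂ (i, j, k) * Circle.negOne ^ (δ₂ (i, j) * δ₁ (j, k)).val) :
    ∀ i j k l : I, c (j, k, l) * (c (i, k, l))⁻¹ * c (i, j, l) * (c (i, j, k))⁻¹ = 1 := by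
  intro i j k l
  have hn : Circle.negOne * Circle.negOne = 1 := by
    apply Subtype.ext
    show (-1 : ℂ) * (-1) = 1
    norm_num
  have hs := sign_cocycle_aux Circle.negOne hn (δ₂ (i, j)) (δ₂ (j, k)) (δ₁ (j, k)) (δ₁ (k, l))
  rw [hδ₂, hδ₁] at hs
  have h1 := hc₁ i j k l
  have h2 := hc₂ i j k l
  rw [hc, hc, hc, hc]
  have h3 := congrArg₂ (· * ·) (congrArg₂ (· * ·) h1 h2) hs
  simp only [mul_one] at h3
  refine Eq.trans ?_ h3
  simp only [mul_inv]
  ac_rfl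
end

section
/- Let H and G be groups, π : H → G a surjective group homomorphism whose kernel is contained in the center of H, G₀ a normal subgroup of G, and s₀ : G₀ → H a group homomorphism with π ∘ s₀ equal to the inclusion of G₀ into G. Then for every t ∈ H, the map φ_t : G₀ → ker π defined by φ_t(g) = t⁻¹ · s₀(g) · t · s₀(π(t)⁻¹ g π(t))⁻¹ is well defined (its values lie in ker π, using that G₀ is normal so that π(t)⁻¹ g π(t) ∈ G₀) and is a group homomorphism. -/
/-- Let `π : H → G` be a surjective homomorphism with central kernel, `G₀` a
normal subgroup of `G`, and `s₀ : G₀ → H` a homomorphic section over `G₀`.  Then for every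
`t ∈ H`, the map `φ_t(g) = t⁻¹ · s₀(g) · t · s₀(π(t)⁻¹ g π(t))⁻¹` is well defined (its values
lie in `ker π`) and is a group homomorphism. -/
theorem conjugation_defect_is_homomorphism
    (H G : Type*) [Group H] [Group G]
    (π : H →* G) (hπsurj : Function.Surjective π) (hker : π.ker ≤ Subgroup.center H)
    (G₀ : Subgroup G) [G₀.Normal]
    (s₀ : G₀ →* H) (hs₀ : ∀ g : G₀, π (s₀ g) = (g : G)) (t : H) :
    (∀ g : G₀, (π t)⁻¹ * (g : G) * π t ∈ G₀) ∧
    (∀ g g' : G₀, (g' : G) = (π t)⁻¹ * (g : G) * π t →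
      t⁻¹ * s₀ g * t * (s₀ g')⁻¹ ∈ π.ker) ∧
    (∀ g₁ g₂ g₁' g₂' : G₀,
      (g₁' : G) = (π t)⁻¹ * (g₁ : G) * π t → (g₂' : G) = (π t)⁻¹ * (g₂ : G) * π t →
      t⁻¹ * s₀ (g₁ * g₂) * t * (s₀ (g₁' * g₂'))⁻¹
        = (t⁻¹ * s₀ g₁ * t * (s₀ g₁')⁻¹) * (t⁻¹ * s₀ g₂ * t * (s₀ g₂')⁻¹)) := by
  have key : ∀ g g' : G₀, (g' : G) = (π t)⁻¹ * (g : G) * π t →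
      t⁻¹ * s₀ g * t * (s₀ g')⁻¹ ∈ π.ker := by
    intro g g' h
    rw [MonoidHom.mem_ker]
    simp only [map_mul, map_inv, hs₀, h]
    group
  refine ⟨fun g => ?_, key, ?_⟩
  · have h := (inferInstance : G₀.Normal).conj_mem g g.2 (π t)⁻¹
    simpa using h
  · intro g₁ g₂ g₁' g₂' _ h₂
    have hc := Subgroup.mem_center_iff.mp (hker (key g₂ g₂' h₂)) (s₀ g₁')⁻¹
    calc t⁻¹ * s₀ (g₁ * g₂) * t * (s₀ (g₁' * g₂'))⁻¹
        = (t⁻¹ * s₀ g₁ * t) * ((t⁻¹ * s₀ g₂ * t * (s₀ g₂')⁻¹) * (s₀ g₁')⁻¹) := by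
          rw [map_mul, map_mul]; group
      _ = (t⁻¹ * s₀ g₁ * t) * ((s₀ g₁')⁻¹ * (t⁻¹ * s₀ g₂ * t * (s₀ g₂')⁻¹)) := by rw [hc]
      _ = _ := by rw [← mul_assoc]
end
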